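/- Bridge outage block localization (impacted blocks, almost surely): fix a bus ĵ ∈ N and a proportional control α, and let E_r be a block of G that is on a simple path between bus ĵ and a participating bus (i.e., there exist a participating bus k and a simple path in G from ĵ to k containing a line of E_r). Then the set of susceptance vectors { b ∈ (0,∞)^m : Σ_{k∈N} α_k D_{l,kĵ}(b) = 0 for some line l ∈ E_r } has m-dimensional Lebesgue measure zero; consequently, for almost every susceptance vector, a bridge outage incident at ĵ changes the branch flow on every line of E_r. -/

import Mathlib

open Matrix MeasureTheory

variable {n m : ℕ}

/-- Incidence matrix of an oriented network with buses `Fin (n+1)` (bus `Fin.last n` is the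
reference bus) and oriented lines indexed by `Fin m` with endpoint maps `src`, `tgt`. -/
def incM (src tgt : Fin m → Fin (n+1)) : Matrix (Fin (n+1)) (Fin m) ℝ :=
  Matrix.of fun i l => if src l = i then 1 else if tgt l = i then -1 else 0

/-- The matrix `A` built from a Laplacian `L`: its top-left `n × n` block is the inverse of the
reduced Laplacian (obtained by deleting the last row and column) and all other entries are `0`. -/
noncomputable def AmatL (L : Matrix (Fin (n+1)) (Fin (n+1)) ℝ) : Matrix (Fin (n+1)) (Fin (n+1)) ℝ :=
  Matrix.of fun i j =>
    if h : i ≠ Fin.last n ∧ j ≠ Fin.last n then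
      (L.submatrix Fin.castSucc Fin.castSucc)⁻¹ (i.castPred h.1) (j.castPred h.2)
    else 0

/-- The matrix `A` of the network with susceptance vector `b`. -/
noncomputable def Amat (src tgt : Fin m → Fin (n+1)) (b : Fin m → ℝ) : Matrix (Fin (n+1)) (Fin (n+1)) ℝ :=
  AmatL (incM src tgt * Matrix.diagonal b * (incM src tgt)ᵀ)

/-- Power transfer distribution factor `D_{l, k ĵ}`. -/
noncomputable def ptdf (src tgt : Fin m → Fin (n+1)) (b : Fin m → ℝ) (l : Fin m) (k jh : Fin (n+1)) : ℝ :=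
  b l * (Amat src tgt b (src l) k + Amat src tgt b (tgt l) jh
       - Amat src tgt b (src l) jh - Amat src tgt b (tgt l) k)

/-- The underlying simple graph of the network. -/
def netGraph (src tgt : Fin m → Fin (n+1)) : SimpleGraph (Fin (n+1)) :=
  SimpleGraph.fromRel fun a c => ∃ l, src l = a ∧ tgt l = c

/-- There is a simple path in the network from `jh` to `k` that contains line `l`. -/
def PathThrough (src tgt : Fin m → Fin (n+1)) (jh k : Fin (n+1)) (l : Fin m) : Prop :=
  ∃ w : (netGraph src tgt).Walk jh k, w.IsPath ∧ s(src l, tgt l) ∈ w.edges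

/-- Lines `e₁` and `e₂` belong to the same block: they are equal or lie on a common simple cycle. -/
def sameBlock (src tgt : Fin m → Fin (n+1)) (e₁ e₂ : Fin m) : Prop :=
  e₁ = e₂ ∨ ∃ (v : Fin (n+1)) (c : (netGraph src tgt).Walk v v),
    c.IsCycle ∧ s(src e₁, tgt e₁) ∈ c.edges ∧ s(src e₂, tgt e₂) ∈ c.edges

/-- A cut vertex: a vertex whose removal disconnects the graph. -/
def IsCutVertex {V : Type*} (G : SimpleGraph V) (v : V) : Prop :=
  ¬ (G.induce {w : V | w ≠ v}).Connected

/-- The subgraph of the network with only the lines in `S`. -/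
def netGraphOn (src tgt : Fin m → Fin (n+1)) (S : Set (Fin m)) : SimpleGraph (Fin (n+1)) :=
  SimpleGraph.fromRel fun a c => ∃ l ∈ S, src l = a ∧ tgt l = c

def maskIn (F : Finset (Fin m)) (b : Fin m → ℝ) : Fin m → ℝ := fun l => if l ∈ F then b l else 0
def maskOut (F : Finset (Fin m)) (b : Fin m → ℝ) : Fin m → ℝ := fun l => if l ∈ F then 0 else b l

/-- Column submatrix `C_F` (columns outside `F` zeroed out). -/
def CFmat (src tgt : Fin m → Fin (n+1)) (F : Finset (Fin m)) : Matrix (Fin (n+1)) (Fin m) ℝ :=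
  Matrix.of fun i l => if l ∈ F then incM src tgt i l else 0

/-- Column submatrix `C_{−F}` (columns in `F` zeroed out). -/
def CmFmat (src tgt : Fin m → Fin (n+1)) (F : Finset (Fin m)) : Matrix (Fin (n+1)) (Fin m) ℝ :=
  Matrix.of fun i l => if l ∈ F then 0 else incM src tgt i l

/-- Diagonal susceptance matrix `B_F`. -/
def BFmat (b : Fin m → ℝ) (F : Finset (Fin m)) : Matrix (Fin m) (Fin m) ℝ :=
  Matrix.diagonal (maskIn F b)

/-- Diagonal susceptance matrix `B_{−F}`. -/
def BmFmat (b : Fin m → ℝ) (F : Finset (Fin m)) : Matrix (Fin m) (Fin m) ℝ :=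
  Matrix.diagonal (maskOut F b)

/-- The matrix `A_{−F}` of the post-contingency network `(N, E ∖ F)`. -/
noncomputable def AmFmat (src tgt : Fin m → Fin (n+1)) (b : Fin m → ℝ) (F : Finset (Fin m)) :
    Matrix (Fin (n+1)) (Fin (n+1)) ℝ :=
  AmatL (CmFmat src tgt F * BmFmat b F * (CmFmat src tgt F)ᵀ)

/-- The `k`-th standard unit vector of `ℝ^{n+1}`. -/
def evec (k : Fin (n+1)) : Fin (n+1) → ℝ := Pi.single k 1

lemma mvpoly_null : ∀ (m : ℕ) (P : MvPolynomial (Fin m) ℝ), P ≠ 0 →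
    volume {b : Fin m → ℝ | MvPolynomial.eval b P = 0} = 0
  | 0, P, hP => by
    have : {b : Fin 0 → ℝ | MvPolynomial.eval b P = 0} = ∅ := by
      ext b
      simp only [Set.mem_ofPred_eq, Set.mem_empty_iff_false, iff_false]
      intro h
      apply hP
      apply MvPolynomial.funext
      intro x
      rw [Subsingleton.elim x b, h, map_zero]
    rw [this, measure_empty]
  | m+1, P, hP => by
    have hmeas : MeasurableSet {b : Fin (m+1) → ℝ | MvPolynomial.eval b P = 0} :=
      (isClosed_eq (MvPolynomial.continuous_eval P) continuous_const).measurableSet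
    have hpres := (volume_preserving_piFinSuccAbove (fun _ : Fin (m+1) => ℝ) 0).symm
    rw [← hpres.measure_preimage hmeas.nullMeasurableSet, Measure.volume_eq_prod,
      Measure.measure_prod_null (hmeas.preimage hpres.measurable)]
    set Q := MvPolynomial.finSuccEquiv ℝ m P with hQ
    have hQ0 : Q ≠ 0 := by simpa [hQ] using hP
    have hfin : {x : ℝ | Q.eval (MvPolynomial.C x) = 0}.Finite := by
      have h1 : {y | Q.IsRoot y}.Finite := Polynomial.finite_setOfPred_isRoot hQ0
      exact h1.preimage ((MvPolynomial.C_injective _ _).injOn)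
    have hae : ∀ᵐ x : ℝ, Q.eval (MvPolynomial.C x) ≠ 0 := by
      rw [ae_iff]
      simpa using hfin.measure_zero volume
    filter_upwards [hae] with x hx
    have := mvpoly_null m _ hx
    simp only [Pi.zero_apply]
    convert this using 2
    ext y
    simp only [Set.mem_preimage, Set.mem_ofPred_eq]
    have e1 : (MeasurableEquiv.piFinSuccAbove (fun _ : Fin (m+1) => ℝ) 0).symm (x, y) = Fin.cons x y := by
      simp [MeasurableEquiv.piFinSuccAbove, Fin.insertNthEquiv]
    rw [e1, MvPolynomial.eval_eq_eval_mv_eval', ← hQ, Polynomial.eval_map, Polynomial.eval,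
      Polynomial.hom_eval₂]
    simp

namespace SimpleGraph.Walk
variable {V : Type*} {G : SimpleGraph V}

lemma exists_first (X : Set V) {a b : V} (p : G.Walk a b) (h : ∃ z ∈ p.support, z ∈ X) :
    ∃ x, x ∈ X ∧ ∃ (q : G.Walk a x) (r : G.Walk x b), p = q.append r ∧
      ∀ z ∈ q.support, z ∈ X → z = x := by
  induction p with
  | nil =>
    obtain ⟨z, hz, hX⟩ := h
    simp only [support_nil, List.mem_singleton] at hz
    subst hz
    exact ⟨z, hX, nil, nil, rfl, by simp⟩
  | @cons u v w hadj p ih =>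
    by_cases hu : u ∈ X
    · exact ⟨u, hu, nil, cons hadj p, rfl, by simp⟩
    · obtain ⟨x, hx, q, r, rfl, hq⟩ := ih (by
        obtain ⟨z, hz, hX⟩ := h
        rw [support_cons, List.mem_cons] at hz
        rcases hz with rfl | hz
        · exact absurd hX hu
        · exact ⟨z, hz, hX⟩)
      refine ⟨x, hx, cons hadj q, r, rfl, ?_⟩
      intro z hz hX
      rw [support_cons, List.mem_cons] at hz
      rcases hz with rfl | hz
      · exact absurd hX hu
      · exact hq z hz hX

lemma isPath_append' {a b c : V} {p : G.Walk a b} {q : G.Walk b c} (hp : p.IsPath) (hq : q.IsPath)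
    (h : ∀ z ∈ p.support, z ∈ q.support → z = b) : (p.append q).IsPath := by
  rw [isPath_def, support_append, List.nodup_append]
  refine ⟨hp.support_nodup, hq.support_nodup.tail, ?_⟩
  rintro z hz w hw rfl
  have := h z hz (List.mem_of_mem_tail hw)
  subst this
  have h2 := hq.support_nodup
  rw [← cons_tail_support] at h2
  exact (List.nodup_cons.1 h2).1 hw

/-- the two arcs of a cycle -/
lemma cycle_arc [DecidableEq V] {v x y : V} (c : G.Walk v v) (hc : c.IsCycle) (hx : x ∈ c.support)
    (hy : y ∈ c.support) (hxy : x ≠ y) (e : Sym2 V) (he : e ∈ c.edges) :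
    ∃ p : G.Walk x y, p.IsPath ∧ e ∈ p.edges ∧ ∀ z ∈ p.support, z ∈ c.support := by
  have hc' : (c.rotate x hx).IsCycle := hc.rotate hx
  have hy' : y ∈ (c.rotate x hx).support := (mem_support_rotate_iff c x hx).2 hy
  have he' : e ∈ (c.rotate x hx).edges := (rotate_edges c x hx).perm.mem_iff.2 he
  have hsp := take_spec (c.rotate x hx) hy'
  have hsub : ∀ z ∈ (c.rotate x hx).support, z ∈ c.support := fun z hz =>
    (mem_support_rotate_iff c x hx).1 hz
  generalize c.rotate x hx = d at *
  generalize d.takeUntil y hy' = p at *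
  generalize d.dropUntil y hy' = q at *
  subst hsp
  have hp : p.IsPath := hc'.isPath_of_append_left (fun h => hxy h.eq.symm)
  have hq : q.IsPath := hc'.isPath_of_append_right (fun h => hxy h.eq)
  rw [edges_append, List.mem_append] at he'
  rcases he' with h | h
  · exact ⟨p, hp, h, fun z hz => hsub z (by simp [hz])⟩
  · exact ⟨q.reverse, hq.reverse, by simpa using h, fun z hz => hsub z (by
      simp only [support_reverse, List.mem_reverse] at hz; simp [hz])⟩

lemma path_step [DecidableEq V] {j k v : V} {w : G.Walk j k} (hw : w.IsPath) {c : G.Walk v v}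
    (hc : c.IsCycle) {e f : Sym2 V} (hew : e ∈ w.edges) (hec : e ∈ c.edges) (hf : f ∈ c.edges) :
    ∃ w' : G.Walk j k, w'.IsPath ∧ f ∈ w'.edges := by
  induction e using Sym2.ind with
  | _ s t =>
  have hst : s ≠ t := (w.adj_of_mem_edges hew).ne
  have hsw := w.fst_mem_support_of_mem_edges hew
  have htw := w.snd_mem_support_of_mem_edges hew
  have hsc := c.fst_mem_support_of_mem_edges hec
  have htc := c.snd_mem_support_of_mem_edges hec
  obtain ⟨x, hx, q, r, rfl, hq⟩ := exists_first {z | z ∈ c.support} w ⟨s, hsw, hsc⟩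
  obtain ⟨y, hy, q', r', hr, hq'⟩ := exists_first {z | z ∈ c.support} r.reverse ⟨x, by simp, hx⟩
  simp only [Set.mem_ofPred_eq] at hx hy hq hq'
  have hr2 : r = r'.reverse.append q'.reverse := by
    rw [← reverse_append, ← hr, reverse_reverse]
  subst hr2
  have hrp := hw.of_append_right
  have hxy : x ≠ y := by
    rintro rfl
    have hr' : r' = nil := by
      have := hrp.of_append_left
      rw [isPath_iff_nil, ← eq_nil_iff_nil] at this
      simpa using congrArg reverse this
    have key : ∀ z ∈ (q.append (r'.reverse.append q'.reverse)).support, z ∈ c.support → z = x := by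
      intro z hz hzc
      subst hr'
      simp only [mem_support_append_iff, support_reverse, List.mem_reverse] at hz
      rcases hz with h | h | h
      · exact hq z h hzc
      · simpa using h
      · exact hq' z h hzc
    exact hst ((key s hsw hsc).trans (key t htw htc).symm)
  obtain ⟨a, ha, hfa, hac⟩ := cycle_arc c hc hx hy hxy f hf
  refine ⟨q.append (a.append q'.reverse), ?_, by simp [hfa]⟩
  refine isPath_append' hw.of_append_left (isPath_append' ha hrp.of_append_right ?_) ?_
  · intro z hz hz'
    exact hq' z (by simpa using hz') (hac z hz)
  · intro z hz hz'
    rw [mem_support_append_iff] at hz'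
    rcases hz' with h | h
    · exact hq z hz (hac z h)
    · by_contra hzx
      exact hw.ne_of_mem_support_of_append hzx hz (by simp at h; simp [h]) rfl

/-- split a path at an edge -/
lemma split_edge {j k s t : V} (w : G.Walk j k) (hw : w.IsPath) (he : s(s,t) ∈ w.edges) :
    ∃ u v, s(u,v) = s(s,t) ∧ ∃ (p : G.Walk j u) (q : G.Walk v k),
      (∀ z ∈ q.support, z ∉ p.support) ∧ ∀ z ∈ q.support, z ∈ w.support := by
  induction w with
  | nil => simp at he
  | @cons a b c hadj p ih =>
    rw [cons_isPath_iff] at hw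
    rw [edges_cons, List.mem_cons] at he
    rcases he with h | h
    · refine ⟨a, b, h.symm, nil, p, ?_, fun z hz => by simp [hz]⟩
      intro z hz hz'
      simp only [support_nil, List.mem_singleton] at hz'
      exact hw.2 (hz' ▸ hz)
    · obtain ⟨u, v, huv, p', q', hd, hs⟩ := ih hw.1 h
      refine ⟨u, v, huv, cons hadj p', q', ?_, fun z hz => by simp [hs z hz]⟩
      intro z hz hz'
      rw [support_cons, List.mem_cons] at hz'
      rcases hz' with rfl | hz'
      · exact hw.2 (hs _ hz)
      · exact hd z hz hz'

/-- two disjoint walks extend to a partition of a connected graph into two connected parts -/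
lemma exists_cut (hG : G.Connected) {j u v k : V} (p : G.Walk j u) (q : G.Walk v k)
    (hd : ∀ z ∈ q.support, z ∉ p.support) :
    ∃ T : Set V, k ∈ T ∧ v ∈ T ∧ j ∉ T ∧ u ∉ T ∧
      ∀ x : V → ℝ, (∀ a b, G.Adj a b → (a ∈ T ↔ b ∈ T) → x a = x b) → x u = x v →
        ∀ a, x a = x u := by
  have hend : ∀ x (r : G.Walk v x), (∀ z ∈ r.support, z ∉ p.support) → x ∉ p.support :=
    fun x r hr => hr x r.end_mem_support
  let T : Set V := {x | ∃ r : G.Walk v x, ∀ z ∈ r.support, z ∉ p.support}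
  have hTp : ∀ z ∈ p.support, z ∉ T := fun z hz ⟨r, hr⟩ => hend z r hr hz
  have hvT : v ∈ T := ⟨nil, fun z hz => by
    simp only [support_nil, List.mem_singleton] at hz
    exact hz ▸ hd v q.start_mem_support⟩
  have hstep : ∀ a b, G.Adj a b → a ∈ T → b ∉ p.support → b ∈ T := by
    rintro a b hab ⟨r, hr⟩ hb
    refine ⟨r.concat hab, fun z hz => ?_⟩
    rw [support_concat, List.mem_append, List.mem_singleton] at hz
    rcases hz with hz | rfl
    · exact hr z hz
    · exact hb
  refine ⟨T, ⟨q, hd⟩, hvT, hTp _ p.start_mem_support, hTp _ p.end_mem_support, ?_⟩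
  intro x hx huv a
  have h1 : ∀ (s a : V) (r : G.Walk s a), s ∈ T → (∀ z ∈ r.support, z ∉ p.support) →
      x a = x s := by
    intro s a r
    induction r with
    | nil => intros; rfl
    | @cons s b a hadj r ih =>
      intro hs hr
      have hb : b ∈ T := hstep s b hadj hs (hr b (by simp))
      rw [ih hb (fun z hz => hr z (by simp [hz]))]
      exact (hx s b hadj (iff_of_true hs hb)).symm
  have h2 : ∀ (s t : V) (r : G.Walk s t), (∀ z ∈ r.support, z ∉ T) →
      ∀ z ∈ r.support, x z = x t := by
    intro s t r
    induction r with
    | nil =>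
      intro _ z hz
      simp only [support_nil, List.mem_singleton] at hz
      rw [hz]
    | @cons s b a hadj r ih =>
      intro hr z hz
      have ih' := ih (fun z hz => hr z (by simp [hz]))
      rw [support_cons, List.mem_cons] at hz
      rcases hz with rfl | hz
      · rw [← ih' b r.start_mem_support]
        exact hx _ _ hadj (iff_of_false (hr _ (by simp)) (hr _ (by simp)))
      · exact ih' z hz
  have h2' := h2 _ _ p hTp
  have h3 : ∀ (a t : V) (r : G.Walk a t), t = u → a ∉ T → x a = x u := by
    intro a t r
    induction r with
    | nil => rintro rfl _; rfl
    | @cons s b a hadj r ih =>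
      intro ht hs
      by_cases hb : b ∈ T
      · apply h2'
        by_contra hsp
        exact hs (hstep b s hadj.symm hb hsp)
      · rw [← ih ht hb]
        exact hx _ _ hadj (iff_of_false hs hb)
  by_cases ha : a ∈ T
  · obtain ⟨r, hr⟩ := ha
    rw [h1 v a r hvT hr, huv]
  · obtain ⟨r⟩ := hG.preconnected a u
    exact h3 a u r rfl ha
end SimpleGraph.Walk

lemma incM_vecMul (src tgt : Fin m → Fin (n+1)) (hsl : ∀ l, src l ≠ tgt l)
    (y : Fin (n+1) → ℝ) (l : Fin m) :
    ((incM src tgt)ᵀ *ᵥ y) l = y (src l) - y (tgt l) := by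
  have : ∀ i, (incM src tgt)ᵀ l i * y i =
      (if src l = i then y i else 0) - (if tgt l = i then y i else 0) := by
    intro i
    have := hsl l
    simp only [incM, transpose_apply, of_apply]
    split_ifs with h1 h2
    · exact absurd (h1.trans h2.symm) this
    all_goals simp
  simp only [mulVec, dotProduct]
  rw [Finset.sum_congr rfl (fun i _ => this i)]
  simp

lemma lap_form (src tgt : Fin m → Fin (n+1)) (hsl : ∀ l, src l ≠ tgt l) (b : Fin m → ℝ)
    (y z : Fin (n+1) → ℝ) :
    y ⬝ᵥ ((incM src tgt * Matrix.diagonal b * (incM src tgt)ᵀ) *ᵥ z) =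
      ∑ l, b l * (y (src l) - y (tgt l)) * (z (src l) - z (tgt l)) := by
  rw [← mulVec_mulVec, ← mulVec_mulVec, dotProduct_mulVec, ← mulVec_transpose]
  simp only [dotProduct, mulVec_diagonal, incM_vecMul src tgt hsl]
  exact Finset.sum_congr rfl fun l _ => by ring

lemma reduce_form (L : Matrix (Fin (n+1)) (Fin (n+1)) ℝ) (y z : Fin (n+1) → ℝ)
    (hy : y (Fin.last n) = 0) (hz : z (Fin.last n) = 0) :
    y ⬝ᵥ (L *ᵥ z) = (fun i => y (Fin.castSucc i)) ⬝ᵥ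
      ((L.submatrix Fin.castSucc Fin.castSucc) *ᵥ (fun i => z (Fin.castSucc i))) := by
  simp [dotProduct, mulVec, Fin.sum_univ_castSucc, hy, hz]

lemma red_det_ne (src tgt : Fin m → Fin (n+1)) (hsl : ∀ l, src l ≠ tgt l) (b : Fin m → ℝ)
    (hb : ∀ l, 0 ≤ b l)
    (hrig : ∀ x : Fin (n+1) → ℝ, (∀ l, 0 < b l → x (src l) = x (tgt l)) →
      ∀ i, x i = x (Fin.last n)) :
    ((incM src tgt * Matrix.diagonal b * (incM src tgt)ᵀ).submatrix
      Fin.castSucc Fin.castSucc).det ≠ 0 := by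
  intro hdet
  obtain ⟨v, hv, hLv⟩ := Matrix.exists_mulVec_eq_zero_iff.2 hdet
  let x : Fin (n+1) → ℝ := Fin.snoc v 0
  have hx : x (Fin.last n) = 0 := by simp [x]
  have hxv : (fun i => x (Fin.castSucc i)) = v := by ext i; simp [x]
  have h1 := reduce_form (incM src tgt * Matrix.diagonal b * (incM src tgt)ᵀ) x x hx hx
  rw [hxv, hLv, lap_form src tgt hsl, dotProduct_zero] at h1
  have hnn : ∀ l ∈ Finset.univ, 0 ≤ b l * (x (src l) - x (tgt l)) * (x (src l) - x (tgt l)) := by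
    intro l _
    rw [mul_assoc]
    exact mul_nonneg (hb l) (mul_self_nonneg _)
  rw [Finset.sum_eq_zero_iff_of_nonneg hnn] at h1
  apply hv
  have := hrig x (fun l hl => by
    have := h1 l (Finset.mem_univ _)
    rw [mul_assoc, mul_eq_zero, mul_self_eq_zero, sub_eq_zero] at this
    exact this.resolve_left hl.ne')
  ext i
  rw [← hxv]
  simp [this, hx]

/-- flow sums through the potential -/
lemma sum_ptdf (src tgt : Fin m → Fin (n+1)) (b : Fin m → ℝ) (α : Fin (n+1) → ℝ)
    (hα1 : ∑ k, α k = 1) (j : Fin (n+1)) (l : Fin m) :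
    ∑ k, α k * ptdf src tgt b l k j =
      b l * ((Amat src tgt b *ᵥ (α - Pi.single j 1)) (src l)
        - (Amat src tgt b *ᵥ (α - Pi.single j 1)) (tgt l)) := by
  have : ∀ k, α k * ptdf src tgt b l k j = b l * (Amat src tgt b (src l) k * α k
      - Amat src tgt b (tgt l) k * α k) +
      α k * (b l * (Amat src tgt b (tgt l) j - Amat src tgt b (src l) j)) := by
    intro k
    rw [ptdf]
    ring
  rw [Finset.sum_congr rfl (fun k _ => this k), Finset.sum_add_distrib, ← Finset.sum_mul, hα1,
    ← Finset.mul_sum, Finset.sum_sub_distrib]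
  simp only [mulVec_sub, Pi.sub_apply, mulVec_single_one, col_apply]
  simp only [mulVec, dotProduct]
  ring

lemma pairing (src tgt : Fin m → Fin (n+1)) (b : Fin m → ℝ) (β y : Fin (n+1) → ℝ)
    (hy : y (Fin.last n) = 0)
    (hdet : ((incM src tgt * Matrix.diagonal b * (incM src tgt)ᵀ).submatrix
      Fin.castSucc Fin.castSucc).det ≠ 0) :
    y ⬝ᵥ ((incM src tgt * Matrix.diagonal b * (incM src tgt)ᵀ) *ᵥ (Amat src tgt b *ᵥ β))
      = y ⬝ᵥ β := by
  rw [Amat]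
  generalize incM src tgt * Matrix.diagonal b * (incM src tgt)ᵀ = L at *
  rw [reduce_form L y _ hy (by simp [AmatL, mulVec, dotProduct])]
  have h2 : (fun i : Fin n => (AmatL L *ᵥ β) i.castSucc) =
      (L.submatrix Fin.castSucc Fin.castSucc)⁻¹ *ᵥ (fun i => β i.castSucc) := by
    ext i
    simp [AmatL, mulVec, dotProduct, Fin.sum_univ_castSucc, Fin.castSucc_ne_last]
  rw [h2, mulVec_mulVec, Matrix.mul_nonsing_inv _ (isUnit_iff_ne_zero.2 hdet), one_mulVec]
  simp [dotProduct, Fin.sum_univ_castSucc, hy]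

/-- the polynomial matrix of adjugate entries -/
lemma exists_poly (src tgt : Fin m → Fin (n+1)) (i j : Fin (n+1)) :
    ∃ P : MvPolynomial (Fin m) ℝ, ∀ b, Amat src tgt b i j =
      Ring.inverse ((incM src tgt * Matrix.diagonal b * (incM src tgt)ᵀ).submatrix
        Fin.castSucc Fin.castSucc).det * MvPolynomial.eval b P := by
  by_cases h : i ≠ Fin.last n ∧ j ≠ Fin.last n
  · let M : Matrix (Fin (n+1)) (Fin m) (MvPolynomial (Fin m) ℝ) := (incM src tgt).map MvPolynomial.C
    let Lp : Matrix (Fin (n+1)) (Fin (n+1)) (MvPolynomial (Fin m) ℝ) :=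
      M * (Matrix.diagonal MvPolynomial.X : Matrix (Fin m) (Fin m) (MvPolynomial (Fin m) ℝ)) * Mᵀ
    refine ⟨(Lp.submatrix Fin.castSucc Fin.castSucc).adjugate (i.castPred h.1) (j.castPred h.2),
      fun b => ?_⟩
    have h1 : (MvPolynomial.eval b).mapMatrix (Lp.submatrix Fin.castSucc Fin.castSucc) =
        (incM src tgt * Matrix.diagonal b * (incM src tgt)ᵀ).submatrix
          Fin.castSucc Fin.castSucc := by
      ext s t
      simp [Lp, M, Matrix.mul_apply, Matrix.diagonal_apply]
    have h2 := (MvPolynomial.eval b).map_adjugate (Lp.submatrix Fin.castSucc Fin.castSucc)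
    rw [h1] at h2
    have h3 := congrFun (congrFun h2 (i.castPred h.1)) (j.castPred h.2)
    rw [RingHom.mapMatrix_apply, Matrix.map_apply] at h3
    rw [h3]
    simp [Amat, AmatL, h, Matrix.inv_def]
  · exact ⟨0, fun b => by simp only [Amat, AmatL, of_apply, dif_neg h, map_zero, mul_zero]⟩

/-- one line on a simple path -/
lemma line_null (src tgt : Fin m → Fin (n+1)) (hsl : ∀ l, src l ≠ tgt l)
    (hconn : (netGraph src tgt).Connected)
    (α : Fin (n+1) → ℝ) (hα0 : ∀ k, 0 ≤ α k) (hα1 : ∑ k, α k = 1)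
    (j k : Fin (n+1)) (hk : 0 < α k) (l : Fin m) (hp : PathThrough src tgt j k l) :
    volume {b : Fin m → ℝ | (∀ e, 0 < b e) ∧ ∑ k, α k * ptdf src tgt b l k j = 0} = 0 := by
  classical
  choose P hP using exists_poly (n := n) src tgt
  let β : Fin (n+1) → ℝ := α - Pi.single j 1
  let Q : MvPolynomial (Fin m) ℝ := ∑ i, (P (src l) i - P (tgt l) i) * MvPolynomial.C (β i)
  have hQ : ∀ b, ∑ k, α k * ptdf src tgt b l k j = b l *
      (Ring.inverse ((incM src tgt * Matrix.diagonal b * (incM src tgt)ᵀ).submatrix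
        Fin.castSucc Fin.castSucc).det * MvPolynomial.eval b Q) := by
    intro b
    rw [sum_ptdf src tgt b α hα1]
    congr 1
    simp only [mulVec, dotProduct, hP, Q, map_sum, map_mul, map_sub, MvPolynomial.eval_C]
    rw [← Finset.sum_sub_distrib, Finset.mul_sum]
    exact Finset.sum_congr rfl fun i _ => by simp only [β]; ring
  have hadj : ∀ a c, (netGraph src tgt).Adj a c →
      ∃ l, (src l = a ∧ tgt l = c) ∨ (src l = c ∧ tgt l = a) := by
    intro a c h
    rw [netGraph, SimpleGraph.fromRel_adj] at h
    rcases h.2 with ⟨l, h⟩ | ⟨l, h⟩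
    · exact ⟨l, Or.inl h⟩
    · exact ⟨l, Or.inr h⟩
  -- the polynomial is nonzero
  have hQ0 : Q ≠ 0 := by
    intro hQ0
    obtain ⟨w, hw, hlw⟩ := hp
    obtain ⟨u, v, huv, p, q, hd, -⟩ := SimpleGraph.Walk.split_edge w hw hlw
    obtain ⟨T, hkT, hvT, hjT, huT, hcut⟩ := SimpleGraph.Walk.exists_cut hconn p q hd
    let b : Fin m → ℝ := fun e => if e = l ∨ (src e ∈ T ↔ tgt e ∈ T) then 1 else 0
    have hb0 : ∀ e, 0 ≤ b e := fun e => by simp only [b]; split_ifs <;> norm_num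
    have hdet := red_det_ne src tgt hsl b hb0 (by
      intro x hx
      have hxuv : x u = x v := by
        have := hx l (by simp [b])
        rcases Sym2.eq_iff.1 huv with ⟨rfl, rfl⟩ | ⟨rfl, rfl⟩
        · exact this
        · exact this.symm
      have := hcut x (by
        intro a c hac hT
        obtain ⟨e, ⟨rfl, rfl⟩ | ⟨rfl, rfl⟩⟩ := hadj a c hac
        · exact hx e (by simp [b, hT])
        · exact (hx e (by simp [b, hT])).symm) hxuv
      intro i
      rw [this i, this (Fin.last n)])
    let y : Fin (n+1) → ℝ := fun i => (if i ∈ T then 1 else 0) - (if Fin.last n ∈ T then 1 else 0)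
    have hpair := pairing src tgt b β y (by simp [y]) hdet
    rw [lap_form src tgt hsl] at hpair
    have hsum := hQ b
    rw [hQ0, map_zero, mul_zero, mul_zero, sum_ptdf src tgt b α hα1] at hsum
    have hbl : b l = 1 := by simp [b]
    rw [hbl, one_mul] at hsum
    have hzero : ∀ e ∈ Finset.univ, b e * (y (src e) - y (tgt e)) *
        ((Amat src tgt b *ᵥ β) (src e) - (Amat src tgt b *ᵥ β) (tgt e)) = 0 := by
      intro e _
      by_cases hel : e = l
      · rw [hel]
        simp only [β]
        rw [hsum, mul_zero]
      · by_cases hT : (src e ∈ T ↔ tgt e ∈ T)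
        · simp [y, hT]
        · simp [b, hel, hT]
    rw [Finset.sum_eq_zero hzero] at hpair
    have hβ : ∑ i, β i = 0 := by simp [β, hα1]
    have : y ⬝ᵥ β = ∑ i, if i ∈ T then α i else 0 := by
      simp only [dotProduct, y, sub_mul]
      rw [Finset.sum_sub_distrib, ← Finset.mul_sum, hβ, mul_zero, sub_zero]
      refine Finset.sum_congr rfl fun i _ => ?_
      by_cases hi : i ∈ T
      · have : i ≠ j := fun h => hjT (h ▸ hi)
        simp [hi, β, this]
      · simp [hi]
    rw [this] at hpair
    have hle : α k ≤ ∑ i, if i ∈ T then α i else 0 := by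
      have := Finset.single_le_sum (f := fun i => if i ∈ T then α i else 0)
        (fun i _ => by split_ifs; exacts [hα0 i, le_rfl]) (Finset.mem_univ k)
      simpa [hkT] using this
    linarith
  refine measure_mono_null ?_ (mvpoly_null m Q hQ0)
  rintro b ⟨hb, hs⟩
  have hdet := red_det_ne src tgt hsl b (fun l => (hb l).le) (by
    intro x hx i
    obtain ⟨r⟩ := hconn.preconnected i (Fin.last n)
    generalize Fin.last n = t at r
    induction r with
    | nil => rfl
    | @cons a c d hac r ih =>
      rw [← ih]
      obtain ⟨e, ⟨rfl, rfl⟩ | ⟨rfl, rfl⟩⟩ := hadj a c hac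
      · exact hx e (hb e)
      · exact (hx e (hb e)).symm)
  rw [hQ b] at hs
  rcases mul_eq_zero.1 hs with h | h
  · exact absurd h (hb l).ne'
  · rcases mul_eq_zero.1 h with h | h
    · rw [Ring.inverse_eq_inv', inv_eq_zero] at h
      exact absurd h hdet
    · exact h

lemma pathThrough_step (src tgt : Fin m → Fin (n+1)) (j k : Fin (n+1)) (e f : Fin m)
    (h : PathThrough src tgt j k e)
    (hs : sameBlock src tgt e f ∨ sameBlock src tgt f e) : PathThrough src tgt j k f := by
  obtain ⟨w, hw, he⟩ := h
  rcases hs with (rfl | ⟨v, c, hc, h1, h2⟩) | (rfl | ⟨v, c, hc, h1, h2⟩)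
  · exact ⟨w, hw, he⟩
  · exact SimpleGraph.Walk.path_step hw hc he h1 h2
  · exact ⟨w, hw, he⟩
  · exact SimpleGraph.Walk.path_step hw hc he h2 h1

/-- bridge outage block localization, impacted blocks, almost surely.
If a block `Er` is on a simple path between `jhat` and a participating bus, then the set of
positive susceptance vectors for which `∑_k α_k D_{l,kĵ}(b) = 0` for some line `l ∈ Er` has
`m`-dimensional Lebesgue measure zero; hence for almost every susceptance vector a bridge
outage incident at `jhat` changes the branch flow on every line of `Er`. -/
theorem bridge_outage_block_impacted_ae
    {n m : ℕ} (src tgt : Fin m → Fin (n+1)) (hsl : ∀ l, src l ≠ tgt l)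
    (hconn : (netGraph src tgt).Connected)
    (α : Fin (n+1) → ℝ) (hα0 : ∀ k, 0 ≤ α k) (hα1 : ∑ k, α k = 1)
    (jhat : Fin (n+1))
    (Er : Set (Fin m)) (hEr : ∃ e₀, Er = {e | sameBlock src tgt e₀ e})
    (hon : ∃ k, 0 < α k ∧ ∃ e ∈ Er, PathThrough src tgt jhat k e) :
    volume {b : Fin m → ℝ | (∀ e, 0 < b e) ∧
      ∃ l ∈ Er, ∑ k, α k * ptdf src tgt b l k jhat = 0} = 0 := by
  obtain ⟨k, hk, e, he, hp⟩ := hon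
  obtain ⟨e₀, rfl⟩ := hEr
  have hsub : {b : Fin m → ℝ | (∀ e, 0 < b e) ∧
      ∃ l ∈ {e | sameBlock src tgt e₀ e}, ∑ k, α k * ptdf src tgt b l k jhat = 0} ⊆
      ⋃ l ∈ {e | sameBlock src tgt e₀ e},
        {b : Fin m → ℝ | (∀ e, 0 < b e) ∧ ∑ k, α k * ptdf src tgt b l k jhat = 0} := by
    rintro b ⟨hb, l, hl, hs⟩
    exact Set.mem_biUnion hl ⟨hb, hs⟩
  refine measure_mono_null hsub ((measure_biUnion_null_iff (Set.to_countable _)).2 ?_)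
  intro l hl
  exact line_null src tgt hsl hconn α hα0 hα1 jhat k hk l
    (pathThrough_step src tgt jhat k e₀ l (pathThrough_step src tgt jhat k e e₀ hp (Or.inr he))
      (Or.inl hl))
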